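/- arXiv:1511.01790 — 3 statements merged into one kernel-verified Lean document; each statement's English description precedes it below -/
import Mathlib

section
/- Let G be a finite connected unicyclic graph on n vertices, let a and b be two distinct pendant vertices (vertices of degree 1) of G, let c be the unique neighbor of b, with c ≠ a, and suppose Kf_a(G) ≥ Kf_b(G). Let G' be the graph obtained from G by deleting the edge cb and adding the edge ab. Then Kf(G') > Kf(G). -/
open scoped Classical

noncomputable section

namespace KfPaper

variable {V : Type*} {W : Type*}

/-- The energy of a potential `f` on graph `G`, viewing each edge as a unit resistor:
`(1/2) · ∑_{x,y adjacent} (f x - f y)²` (each edge counted twice, hence the `1/2`). -/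
def energy [Fintype V] (G : SimpleGraph V) (f : V → ℝ) : ℝ :=
  (1 / 2) * ∑ x : V, ∑ y : V, (if G.Adj x y then (f x - f y) ^ 2 else 0)

/-- The resistance distance (effective resistance) between `u` and `v`:
`r(u,v) = 1 / inf { energy f : f u = 1, f v = 0 }` and `r(u,u) = 0`. -/
def resistanceDistance [Fintype V] (G : SimpleGraph V) (u v : V) : ℝ :=
  if u = v then 0
  else 1 / sInf {e : ℝ | ∃ f : V → ℝ, f u = 1 ∧ f v = 0 ∧ energy G f = e}

/-- The Kirchhoff index: sum of resistance distances over unordered pairs of distinct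
vertices (each ordered pair counted once via the factor `1/2`, diagonal terms vanish). -/
def kirchhoffIndex [Fintype V] (G : SimpleGraph V) : ℝ :=
  (1 / 2) * ∑ u : V, ∑ v : V, resistanceDistance G u v

/-- `Kf_v(G) = ∑_{u ≠ v} r(v,u)` (the term `u = v` contributes `0`). -/
def kirchhoffAt [Fintype V] (G : SimpleGraph V) (v : V) : ℝ :=
  ∑ u : V, resistanceDistance G v u

/-- The Wiener index: sum of graph distances over unordered pairs of distinct vertices. -/
def wienerIndex [Fintype V] (G : SimpleGraph V) : ℝ :=
  (1 / 2) * ∑ u : V, ∑ v : V, (G.dist u v : ℝ)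

/-- `W_v(G) = ∑_u d(v,u)`. -/
def wienerAt [Fintype V] (G : SimpleGraph V) (v : V) : ℝ :=
  ∑ u : V, (G.dist v u : ℝ)

/-- The degree of a vertex. -/
def degree' (G : SimpleGraph V) (v : V) : ℕ := Nat.card (G.neighborSet v)

/-- `G` has maximum degree `Δ`. -/
def HasMaxDegree (G : SimpleGraph V) (Δ : ℕ) : Prop :=
  (∀ v, degree' G v ≤ Δ) ∧ ∃ v, degree' G v = Δ

/-- A unicyclic graph: a connected graph containing exactly one cycle, equivalently a
connected graph with as many edges as vertices. -/
def IsUnicyclic [Fintype V] (G : SimpleGraph V) : Prop :=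
  G.Connected ∧ Nat.card G.edgeSet = Fintype.card V

section Energy

variable [Fintype V]

lemma energy_nonneg (G : SimpleGraph V) (f : V → ℝ) : 0 ≤ energy G f := by
  unfold energy
  refine mul_nonneg (by norm_num) (Finset.sum_nonneg fun x _ => Finset.sum_nonneg fun y _ => ?_)
  split_ifs <;> positivity

lemma energy_smul (G : SimpleGraph V) (t : ℝ) (f : V → ℝ) :
    energy G (fun x => t * f x) = t ^ 2 * energy G f := by
  unfold energy
  rw [mul_left_comm]
  congr 1
  simp only [Finset.mul_sum]
  refine Finset.sum_congr rfl fun x _ => Finset.sum_congr rfl fun y _ => ?_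
  split_ifs <;> ring

lemma energy_one_sub (G : SimpleGraph V) (f : V → ℝ) :
    energy G (fun x => 1 - f x) = energy G f := by
  unfold energy
  congr 1
  refine Finset.sum_congr rfl fun x _ => Finset.sum_congr rfl fun y _ => ?_
  split_ifs <;> ring

/-- The energy ignores the value of the potential at an isolated vertex. -/
lemma energy_update_of_isolated {H : SimpleGraph V} {b : V} (hb : ∀ y, ¬ H.Adj b y)
    (f : V → ℝ) (t : ℝ) : energy H (Function.update f b t) = energy H f := by
  unfold energy
  congr 1
  refine Finset.sum_congr rfl fun x _ => Finset.sum_congr rfl fun y _ => ?_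
  by_cases h : H.Adj x y
  · have hx : x ≠ b := by rintro rfl; exact hb _ h
    have hy : y ≠ b := by rintro rfl; exact hb _ h.symm
    simp [hx, hy]
  · simp [h]

/-- Attaching an isolated vertex `b` to `c` adds the energy of the new edge. -/
lemma energy_sup_edge {H : SimpleGraph V} {b c : V} (hb : ∀ y, ¬ H.Adj b y) (hbc : b ≠ c)
    (f : V → ℝ) : energy (H ⊔ SimpleGraph.edge b c) f = energy H f + (f b - f c) ^ 2 := by
  have key : ∀ x y : V, (if (H ⊔ SimpleGraph.edge b c).Adj x y then (f x - f y) ^ 2 else 0)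
      = (if H.Adj x y then (f x - f y) ^ 2 else 0)
        + ((if x = b then (if y = c then (f b - f c) ^ 2 else 0) else 0)
        + (if x = c then (if y = b then (f b - f c) ^ 2 else 0) else 0)) := by
    intro x y
    have h1 : ∀ y, ¬ H.Adj y b := fun y h => hb y h.symm
    simp only [SimpleGraph.sup_adj, SimpleGraph.edge_adj]
    by_cases hx : x = b
    · subst hx
      by_cases hy : y = c
      · subst hy; simp [hb, hbc]
      · simp [hb, hy, hbc]
    · by_cases hy : y = b
      · subst hy
        by_cases hx' : x = c
        · subst hx'; simp [h1, hx]; ring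
        · simp [h1, hx, hx']
      · simp [hx, hy]
  unfold energy
  have hsum : ∀ p q : V, ∑ x, ∑ y, (if x = p then (if y = q then (f b - f c) ^ 2 else 0) else 0)
      = (f b - f c) ^ 2 := fun p q => by simp [Finset.sum_ite_irrel]
  have hkey := Finset.sum_congr (rfl : (Finset.univ : Finset V) = _) fun x _ =>
    Finset.sum_congr (rfl : (Finset.univ : Finset V) = _) fun y _ => key x y
  simp_rw [Finset.sum_add_distrib, hsum] at hkey
  refine Eq.trans (b := (1 / 2 : ℝ) * _) (congrArg _ (Eq.trans ?_ hkey)) (by ring)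
  congr!

/-- Energies of the potentials equal to `1` at `u` and to `0` at `v`. -/
def energySet (G : SimpleGraph V) (u v : V) : Set ℝ :=
  {e : ℝ | ∃ f : V → ℝ, f u = 1 ∧ f v = 0 ∧ energy G f = e}

lemma resistanceDistance_of_ne (G : SimpleGraph V) {u v : V} (h : u ≠ v) :
    resistanceDistance G u v = 1 / sInf (energySet G u v) := by
  simp [resistanceDistance, h, energySet]

lemma resistanceDistance_self (G : SimpleGraph V) (u : V) : resistanceDistance G u u = 0 := by
  simp [resistanceDistance]

lemma energySet_comm (G : SimpleGraph V) (u v : V) : energySet G u v = energySet G v u := by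
  have key : ∀ u v : V, energySet G u v ⊆ energySet G v u := by
    rintro u v e ⟨f, hu, hv, he⟩
    exact ⟨fun x => 1 - f x, by simp [hv], by simp [hu], by rw [energy_one_sub, he]⟩
  exact (key u v).antisymm (key v u)

lemma resistanceDistance_comm (G : SimpleGraph V) (u v : V) :
    resistanceDistance G u v = resistanceDistance G v u := by
  by_cases h : u = v
  · rw [h]
  · rw [resistanceDistance_of_ne G h, resistanceDistance_of_ne G (Ne.symm h), energySet_comm]

lemma energySet_nonempty (G : SimpleGraph V) {u v : V} (h : u ≠ v) :
    (energySet G u v).Nonempty :=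
  ⟨_, Pi.single u 1, by simp, by simp [h.symm], rfl⟩

lemma energySet_bddBelow (G : SimpleGraph V) (u v : V) : BddBelow (energySet G u v) :=
  ⟨0, by rintro _ ⟨f, -, -, rfl⟩; exact energy_nonneg G f⟩

lemma sInf_energySet_sup_edge {H : SimpleGraph V} {b c x y : V} (hb : ∀ y, ¬ H.Adj b y)
    (hbc : b ≠ c) (hx : x ≠ b) (hy : y ≠ b) (hxy : x ≠ y) :
    sInf (energySet (H ⊔ SimpleGraph.edge b c) x y) = sInf (energySet H x y) := by
  apply le_antisymm
  · refine le_csInf (energySet_nonempty H hxy) ?_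
    rintro _ ⟨f, hfx, hfy, rfl⟩
    refine csInf_le (energySet_bddBelow _ _ _)
      ⟨Function.update f b (f c), by simp [hx, hfx], by simp [hy, hfy], ?_⟩
    rw [energy_sup_edge hb hbc, energy_update_of_isolated hb]
    simp [hbc.symm]
  · refine le_csInf (energySet_nonempty _ hxy) ?_
    rintro _ ⟨f, hfx, hfy, rfl⟩
    refine (csInf_le (energySet_bddBelow _ _ _) ⟨f, hfx, hfy, rfl⟩).trans ?_
    rw [energy_sup_edge hb hbc]
    nlinarith [sq_nonneg (f b - f c)]

/-- Attaching a pendant vertex does not change resistances between the other vertices. -/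
lemma resistanceDistance_sup_edge {H : SimpleGraph V} {b c x y : V} (hb : ∀ y, ¬ H.Adj b y)
    (hbc : b ≠ c) (hx : x ≠ b) (hy : y ≠ b) :
    resistanceDistance (H ⊔ SimpleGraph.edge b c) x y = resistanceDistance H x y := by
  by_cases hxy : x = y
  · rw [hxy, resistanceDistance_self, resistanceDistance_self]
  · rw [resistanceDistance_of_ne _ hxy, resistanceDistance_of_ne _ hxy,
      sInf_energySet_sup_edge hb hbc hx hy hxy]

lemma sq_mul_sInf_energySet_le (G : SimpleGraph V) {u v : V} (f : V → ℝ) (hv : f v = 0) :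
    f u ^ 2 * sInf (energySet G u v) ≤ energy G f := by
  by_cases h : f u = 0
  · simpa [h] using energy_nonneg G f
  · have h1 : sInf (energySet G u v) ≤ energy G (fun x => (f u)⁻¹ * f x) :=
      csInf_le (energySet_bddBelow _ _ _) ⟨_, by simp [h], by simp [hv], rfl⟩
    rw [energy_smul] at h1
    calc f u ^ 2 * sInf (energySet G u v) ≤ f u ^ 2 * ((f u)⁻¹ ^ 2 * energy G f) := by gcongr
      _ = energy G f := by field_simp

/-- Resistances from a pendant vertex are one more than those from its neighbor. -/
lemma resistanceDistance_pendant {H : SimpleGraph V} {b c x : V} (hb : ∀ y, ¬ H.Adj b y)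
    (hbc : b ≠ c) (hx : x ≠ b) (hpos : c ≠ x → 0 < sInf (energySet H c x)) :
    resistanceDistance (H ⊔ SimpleGraph.edge b c) b x = 1 + resistanceDistance H c x := by
  rw [resistanceDistance_of_ne _ hx.symm]
  by_cases hcx : c = x
  · subst hcx
    rw [resistanceDistance_self, add_zero]
    have : sInf (energySet (H ⊔ SimpleGraph.edge b c) b c) = 1 := by
      apply le_antisymm
      · refine csInf_le (energySet_bddBelow _ _ _)
          ⟨Function.update (fun _ => 0) b 1, by simp, by simp [hx], ?_⟩
        rw [energy_sup_edge hb hbc, energy_update_of_isolated hb]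
        simp [hx, energy]
      · refine le_csInf (energySet_nonempty _ hbc) ?_
        rintro _ ⟨f, hfb, hfc, rfl⟩
        rw [energy_sup_edge hb hbc, hfb, hfc]
        have := energy_nonneg H f
        linarith
    rw [this, div_one]
  · have hC := hpos hcx
    rw [resistanceDistance_of_ne _ hcx]
    set C := sInf (energySet H c x) with hCdef
    have : sInf (energySet (H ⊔ SimpleGraph.edge b c) b x) = C / (1 + C) := by
      apply le_antisymm
      · set m := sInf (energySet (H ⊔ SimpleGraph.edge b c) b x)
        have hm : ∀ e ∈ energySet H c x, m * (1 + e) ≤ e := by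
          rintro e ⟨f, hfc, hfx, rfl⟩
          have he := energy_nonneg H f
          set e := energy H f with hedef
          have h1 : m ≤ e / (1 + e) := by
            refine csInf_le (energySet_bddBelow _ _ _)
              ⟨Function.update (fun y => (1 / (1 + e)) * f y) b 1, by simp, by simp [hx, hfx], ?_⟩
            rw [energy_sup_edge hb hbc, energy_update_of_isolated hb, energy_smul, ← hedef]
            simp only [Function.update_self, Function.update_of_ne hbc.symm, hfc]
            field_simp
            ring
          rwa [le_div_iff₀ (by linarith)] at h1
        have hm1 : m < 1 := by
          obtain ⟨e, he⟩ := energySet_nonempty H hcx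
          have h1 := hm e he
          have h2 : 0 ≤ e := by obtain ⟨f, -, -, rfl⟩ := he; exact energy_nonneg H f
          nlinarith
        have h2 : m / (1 - m) ≤ C := by
          refine le_csInf (energySet_nonempty H hcx) fun e he => ?_
          rw [div_le_iff₀ (by linarith)]
          linarith [hm e he]
        rw [div_le_iff₀ (by linarith)] at h2
        rw [le_div_iff₀ (by linarith)]
        linarith
      · refine le_csInf (energySet_nonempty _ hx.symm) ?_
        rintro _ ⟨f, hfb, hfx, rfl⟩
        rw [energy_sup_edge hb hbc, hfb]
        have h1 : f c ^ 2 * C ≤ energy H f := sq_mul_sInf_energySet_le H f hfx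
        rw [div_le_iff₀ (by linarith)]
        nlinarith [sq_nonneg (f c * (1 + C) - 1)]
    rw [this]
    field_simp
    ring

lemma kirchhoffAt_pendant {H : SimpleGraph V} {b c : V} (hb : ∀ y, ¬ H.Adj b y)
    (hbc : b ≠ c) (hpos : ∀ x, x ≠ b → c ≠ x → 0 < sInf (energySet H c x)) :
    kirchhoffAt (H ⊔ SimpleGraph.edge b c) b
      = ((Fintype.card V : ℝ) - 1) + ∑ x ∈ Finset.univ.erase b, resistanceDistance H c x := by
  have hV : ((Finset.univ.erase b).card : ℝ) = (Fintype.card V : ℝ) - 1 := by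
    rw [Finset.card_erase_of_mem (Finset.mem_univ b), Finset.card_univ,
      Nat.cast_sub (Fintype.card_pos_iff.2 ⟨b⟩), Nat.cast_one]
  rw [kirchhoffAt, ← Finset.add_sum_erase _ _ (Finset.mem_univ b), resistanceDistance_self,
    zero_add, ← hV, Finset.cast_card, ← Finset.sum_add_distrib]
  refine Finset.sum_congr rfl fun x hx => ?_
  have hx := Finset.ne_of_mem_erase hx
  exact resistanceDistance_pendant hb hbc hx (hpos x hx)

/-- Along a path, the sum of the squared potential differences is at most the energy. -/
lemma sum_sq_sub_path_le_energy (G : SimpleGraph V) {u v : V} (p : G.Walk u v) (hp : p.IsPath)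
    (f : V → ℝ) :
    ∑ i ∈ Finset.range p.length, (f (p.getVert i) - f (p.getVert (i + 1))) ^ 2 ≤ energy G f := by
  have hinj : ∀ i ≤ p.length, ∀ j ≤ p.length, p.getVert i = p.getVert j → i = j :=
    fun i hi j hj h => hp.getVert_injOn hi hj h
  let g : V × V → ℝ := fun z => if G.Adj z.1 z.2 then (f z.1 - f z.2) ^ 2 else 0
  have hg : ∀ z, 0 ≤ g z := fun z => by simp only [g]; split_ifs <;> positivity
  let s := Finset.range p.length
  let φ : ℕ → V × V := fun i => (p.getVert i, p.getVert (i + 1))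
  let ψ : ℕ → V × V := fun i => (p.getVert (i + 1), p.getVert i)
  have hφ : Set.InjOn φ s := by
    intro i hi j hj h
    simp only [s, Finset.coe_range, Set.mem_Iio] at hi hj
    exact hinj _ hi.le _ hj.le (congrArg Prod.fst h)
  have hψ : Set.InjOn ψ s := by
    intro i hi j hj h
    simp only [s, Finset.coe_range, Set.mem_Iio] at hi hj
    exact hinj _ hi.le _ hj.le (congrArg Prod.snd h)
  have hdisj : Disjoint (s.image φ) (s.image ψ) := by
    rw [Finset.disjoint_left]
    intro z hz hz'
    obtain ⟨i, hi, rfl⟩ := Finset.mem_image.1 hz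
    obtain ⟨j, hj, h⟩ := Finset.mem_image.1 hz'
    simp only [s, Finset.mem_range] at hi hj
    have h1 := hinj _ (by omega) _ (by omega) (congrArg Prod.fst h)
    have h2 := hinj _ (by omega) _ (by omega) (congrArg Prod.snd h)
    omega
  have hle : ∑ z ∈ s.image φ ∪ s.image ψ, g z ≤ ∑ z, g z :=
    Finset.sum_le_sum_of_subset_of_nonneg (Finset.subset_univ _) fun z _ _ => hg z
  rw [Finset.sum_union hdisj, Finset.sum_image hφ, Finset.sum_image hψ, Fintype.sum_prod_type] at hle
  have e1 : ∑ i ∈ s, g (φ i) = ∑ i ∈ s, (f (p.getVert i) - f (p.getVert (i + 1))) ^ 2 := by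
    refine Finset.sum_congr rfl fun i hi => ?_
    simp [g, φ, p.adj_getVert_succ (Finset.mem_range.1 hi)]
  have e2 : ∑ i ∈ s, g (ψ i) = ∑ i ∈ s, (f (p.getVert i) - f (p.getVert (i + 1))) ^ 2 := by
    refine Finset.sum_congr rfl fun i hi => ?_
    simp only [g, ψ, (p.adj_getVert_succ (Finset.mem_range.1 hi)).symm, if_true]
    ring
  rw [e1, e2] at hle
  unfold energy
  simp only [g] at hle
  linarith

/-- The conductance between two vertices is at least the inverse of their distance. -/
lemma inv_dist_le_sInf_energySet {G : SimpleGraph V} (hG : G.Connected) {u v : V} (h : u ≠ v) :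
    ((G.dist u v : ℝ))⁻¹ ≤ sInf (energySet G u v) := by
  obtain ⟨p, hp, hlen⟩ := hG.exists_path_of_dist u v
  refine le_csInf (energySet_nonempty G h) ?_
  rintro _ ⟨f, hu, hv, rfl⟩
  have hpos : (0 : ℝ) < G.dist u v := by exact_mod_cast hG.pos_dist_of_ne h
  have h1 := sum_sq_sub_path_le_energy G p hp f
  have h2 := sq_sum_le_card_mul_sum_sq (s := Finset.range p.length)
    (f := fun i => f (p.getVert i) - f (p.getVert (i + 1)))
  rw [Finset.sum_range_sub' (fun i => f (p.getVert i)), p.getVert_zero, p.getVert_length, hu, hv,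
    Finset.card_range, hlen] at h2
  rw [hlen] at h1
  rw [inv_le_iff_one_le_mul₀ hpos]
  nlinarith

lemma sInf_energySet_pos {G : SimpleGraph V} (hG : G.Connected) {u v : V} (h : u ≠ v) :
    0 < sInf (energySet G u v) :=
  lt_of_lt_of_le (inv_pos.2 (by exact_mod_cast hG.pos_dist_of_ne h))
    (inv_dist_le_sInf_energySet hG h)

lemma resistanceDistance_le_dist {G : SimpleGraph V} (hG : G.Connected) {u v : V} (h : u ≠ v) :
    resistanceDistance G u v ≤ G.dist u v := by
  have hpos : (0 : ℝ) < G.dist u v := by exact_mod_cast hG.pos_dist_of_ne h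
  rw [resistanceDistance_of_ne G h, one_div]
  exact inv_le_of_inv_le₀ hpos (inv_dist_le_sInf_energySet hG h)

/-- A connected graph with two vertices at distance at least `|V| - 1` has fewer edges than
vertices. -/
lemma card_edgeSet_lt_of_card_le_dist_add_one {G : SimpleGraph V} (hG : G.Connected) {u v : V}
    (h : Fintype.card V ≤ G.dist u v + 1) : Nat.card G.edgeSet < Fintype.card V := by
  obtain ⟨p, hp, hlen⟩ := hG.exists_path_of_dist u v
  have hdist : ∀ i ≤ p.length, G.dist u (p.getVert i) = i := by
    intro i hi
    have h1 : G.dist u (p.getVert i) ≤ i := by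
      have := SimpleGraph.dist_le (p.take i)
      rw [SimpleGraph.Walk.take_length] at this
      omega
    have h2 : G.dist (p.getVert i) v ≤ p.length - i := by
      have := SimpleGraph.dist_le (p.drop i)
      rwa [SimpleGraph.Walk.drop_length] at this
    have h3 := hG.dist_triangle (u := u) (v := p.getVert i) (w := v)
    omega
  have hsurj : ∀ x : V, ∃ i ≤ p.length, p.getVert i = x := by
    have hinj : Set.InjOn p.getVert (Finset.range (p.length + 1)) := by
      intro i hi j hj hij
      simp only [Finset.coe_range, Set.mem_Iio] at hi hj
      exact hp.getVert_injOn (by simp; omega) (by simp; omega) hij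
    have huniv : (Finset.range (p.length + 1)).image p.getVert = Finset.univ := by
      rw [← Finset.card_eq_iff_eq_univ]
      refine le_antisymm (Finset.card_le_univ _) ?_
      rw [Finset.card_image_of_injOn hinj, Finset.card_range]
      omega
    intro x
    have hx : x ∈ (Finset.range (p.length + 1)).image p.getVert := huniv ▸ Finset.mem_univ x
    obtain ⟨i, hi, rfl⟩ := Finset.mem_image.1 hx
    exact ⟨i, by simpa [Nat.lt_succ_iff] using hi, rfl⟩
  have hsub : G.edgeFinset ⊆
      (Finset.range p.length).image (fun i => s(p.getVert i, p.getVert (i + 1))) := by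
    have key : ∀ i ≤ p.length, ∀ j ≤ p.length, i ≤ j → G.Adj (p.getVert i) (p.getVert j) →
        j = i + 1 := by
      intro i hi j hj hij hadj
      have h1 := hG.dist_triangle (u := u) (v := p.getVert i) (w := p.getVert j)
      rw [hdist i hi, hdist j hj, SimpleGraph.dist_eq_one_iff_adj.2 hadj] at h1
      have h2 : i ≠ j := by rintro rfl; exact hadj.ne rfl
      omega
    intro e he
    induction e with
    | _ x y =>
      rw [SimpleGraph.mem_edgeFinset, SimpleGraph.mem_edgeSet] at he
      obtain ⟨i, hi, rfl⟩ := hsurj x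
      obtain ⟨j, hj, rfl⟩ := hsurj y
      rw [Finset.mem_image]
      rcases le_total i j with hij | hij
      · obtain rfl := key i hi j hj hij he
        exact ⟨i, by simpa using hj, rfl⟩
      · obtain rfl := key j hj i hi hij he.symm
        exact ⟨j, by simpa using hi, Sym2.eq_swap⟩
  have hcard := (Finset.card_le_card hsub).trans Finset.card_image_le
  rw [Finset.card_range] at hcard
  have hlt : p.length < Fintype.card V := hp.length_lt
  rw [Nat.card_eq_fintype_card, ← SimpleGraph.edgeFinset_card]
  omega

/-- If the resistances of two graphs agree away from `b`, then their Kirchhoff indices differ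
exactly by the contribution of `b`. -/
lemma kirchhoffIndex_sub_kirchhoffIndex {G G' : SimpleGraph V} {b : V}
    (h : ∀ x y, x ≠ b → y ≠ b → resistanceDistance G' x y = resistanceDistance G x y) :
    kirchhoffIndex G' - kirchhoffIndex G = kirchhoffAt G' b - kirchhoffAt G b := by
  have key : ∀ x y, resistanceDistance G' x y - resistanceDistance G x y
      = (if x = b then resistanceDistance G' b y - resistanceDistance G b y else 0)
        + (if y = b then resistanceDistance G' b x - resistanceDistance G b x else 0) := by
    intro x y
    by_cases hx : x = b
    · subst hx
      by_cases hy : y = x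
      · subst hy; simp [resistanceDistance_self]
      · simp [hy]
    · by_cases hy : y = b
      · subst hy
        simp [hx, resistanceDistance_comm _ x y]
      · simp [hx, hy, h x y hx hy]
  unfold kirchhoffIndex kirchhoffAt
  simp_rw [← mul_sub, ← Finset.sum_sub_distrib]
  rw [Finset.sum_congr rfl fun x _ => Finset.sum_congr rfl fun y _ => key x y]
  simp only [Finset.sum_add_distrib, Finset.sum_ite_eq', Finset.mem_univ, if_true, Finset.sum_ite_irrel,
    Finset.sum_const_zero]
  ring

end Energy

/-- Moving a pendant vertex `b` (with neighbor `c`) so that it becomes attached to another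
pendant vertex `a` with `Kf_a(G) ≥ Kf_b(G)` strictly increases the Kirchhoff index. -/
theorem statement5 [Fintype V] (G : SimpleGraph V) (huni : IsUnicyclic G)
    (a b c : V) (hab : a ≠ b) (hca : c ≠ a)
    (hda : degree' G a = 1) (hdb : degree' G b = 1)
    (hcb : G.Adj c b)
    (hK : kirchhoffAt G b ≤ kirchhoffAt G a) :
    kirchhoffIndex G <
      kirchhoffIndex (SimpleGraph.fromEdgeSet ((G.edgeSet \ {s(c, b)}) ∪ {s(a, b)})) := by
  obtain ⟨hconn, hcard⟩ := huni
  have hbc : b ≠ c := hcb.ne'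
  have hnbr : ∀ y, G.Adj b y → y = c := by
    intro y hy
    obtain ⟨z, hz⟩ := (Nat.card_eq_one_iff_exists (α := G.neighborSet b)).1 hdb
    have h1 := hz ⟨y, hy⟩
    have h2 := hz ⟨c, hcb.symm⟩
    exact congrArg Subtype.val (h1.trans h2.symm)
  set G' := SimpleGraph.fromEdgeSet ((G.edgeSet \ {s(c, b)}) ∪ {s(a, b)})
  let H : SimpleGraph V := G.deleteEdges {s(c, b)}
  have hb : ∀ y, ¬ H.Adj b y := by
    intro y hy
    rw [SimpleGraph.deleteEdges_adj] at hy
    obtain rfl := hnbr y hy.1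
    exact hy.2 Sym2.eq_swap
  have hGH : G = H ⊔ SimpleGraph.edge b c := by
    ext x y
    simp only [H, SimpleGraph.sup_adj, SimpleGraph.deleteEdges_adj, SimpleGraph.edge_adj,
      Set.mem_singleton_iff, Sym2.eq_iff]
    constructor
    · intro h
      have := h.ne
      tauto
    · rintro (h | ⟨⟨rfl, rfl⟩ | ⟨rfl, rfl⟩, -⟩)
      exacts [h.1, hcb.symm, hcb]
  have hGH' : G' = H ⊔ SimpleGraph.edge b a := by
    ext x y
    simp only [G', H, SimpleGraph.sup_adj, SimpleGraph.deleteEdges_adj, SimpleGraph.edge_adj,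
      SimpleGraph.fromEdgeSet_adj, Set.mem_union, Set.mem_sdiff, SimpleGraph.mem_edgeSet,
      Set.mem_singleton_iff, Sym2.eq_iff]
    have := fun h : G.Adj x y => h.ne
    tauto
  have hpos : ∀ x y, x ≠ b → y ≠ b → x ≠ y → 0 < sInf (energySet H x y) := by
    intro x y hx hy hxy
    rw [← sInf_energySet_sup_edge hb hbc hx hy hxy, ← hGH]
    exact sInf_energySet_pos hconn hxy
  have hG : ∀ x y, x ≠ b → y ≠ b → resistanceDistance G x y = resistanceDistance H x y := by
    intro x y hx hy
    conv_lhs => rw [hGH]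
    exact resistanceDistance_sup_edge hb hbc hx hy
  have hdiff := kirchhoffIndex_sub_kirchhoffIndex (G := G) (G' := G') (b := b) fun x y hx hy => by
    rw [hG x y hx hy, hGH', resistanceDistance_sup_edge hb hab.symm hx hy]
  have hsumG : kirchhoffAt G b
      = ((Fintype.card V : ℝ) - 1) + ∑ x ∈ Finset.univ.erase b, resistanceDistance H c x := by
    conv_lhs => rw [hGH]
    exact kirchhoffAt_pendant hb hbc fun x => hpos c x hbc.symm
  have hsumG' : kirchhoffAt G' b
      = ((Fintype.card V : ℝ) - 1) + ∑ x ∈ Finset.univ.erase b, resistanceDistance H a x := by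
    rw [hGH']
    exact kirchhoffAt_pendant hb hab.symm fun x => hpos a x hab
  have hsuma : kirchhoffAt G a
      = resistanceDistance G a b + ∑ x ∈ Finset.univ.erase b, resistanceDistance H a x := by
    rw [kirchhoffAt, ← Finset.add_sum_erase _ _ (Finset.mem_univ b)]
    congr 1
    exact Finset.sum_congr rfl fun x hx => hG a x hab (Finset.ne_of_mem_erase hx)
  have hlt : resistanceDistance G a b < (Fintype.card V : ℝ) - 1 := by
    refine (resistanceDistance_le_dist hconn hab).trans_lt ?_
    have h1 : G.dist a b + 1 < Fintype.card V := by
      by_contra h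
      have := card_edgeSet_lt_of_card_le_dist_add_one hconn (not_lt.1 h)
      omega
    have h2 : (G.dist a b : ℝ) + 1 < Fintype.card V := by exact_mod_cast h1
    linarith
  linarith

end KfPaper
end
end

section
/- Let G be a finite connected simple graph on n vertices with maximum degree Δ ≥ 2. Then W(G) ≤ W(T_{n,Δ}), with equality if and only if G is isomorphic to T_{n,Δ}. -/
open scoped Classical

noncomputable section

namespace KfPaper

variable {V : Type*} {W : Type*}

/-- `T_{n,Δ}`: the tree on `Fin n` given by the path `0,1,…,n−Δ` (a copy of `P_{n−Δ+1}`)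
together with `Δ−1` further vertices `n−Δ+1,…,n−1`, each joined to the end-vertex `n−Δ`
of the path. -/
def TnD (n Δ : ℕ) : SimpleGraph (Fin n) :=
  SimpleGraph.fromRel (fun i j =>
    (i.val + 1 = j.val ∧ j.val ≤ n - Δ) ∨ (i.val = n - Δ ∧ n - Δ < j.val))

section Counting

open Finset

lemma sum_eq_sum_card_filter_lt {α : Type*} [Fintype α] (f : α → ℕ) (M : ℕ)
    (hf : ∀ a, f a ≤ M) :
    ∑ a, f a = ∑ k ∈ range M, (univ.filter fun a => k < f a).card := by
  simp_rw [card_filter]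
  rw [sum_comm]
  refine sum_congr rfl fun a _ => ?_
  rw [← card_filter]
  have : (range M).filter (fun k => k < f a) = range (f a) := by
    ext k
    have := hf a
    simp only [mem_filter, mem_range]
    omega
  rw [this, card_range]

lemma card_fiber_succ_add {α : Type*} [Fintype α] (f : α → ℕ) (c : ℕ) :
    Fintype.card {x // f x = c + 1} + (univ.filter fun x => c + 1 < f x).card =
      (univ.filter fun x => c < f x).card := by
  rw [Fintype.card_subtype, ← card_union_of_disjoint]
  · congr 1
    ext x
    simp only [mem_union, mem_filter, mem_univ, true_and]
    omega
  · rw [disjoint_filter]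
    intro x _ hx
    omega

lemma card_fiber_zero_add {α : Type*} [Fintype α] (f : α → ℕ) :
    Fintype.card {x // f x = 0} + (univ.filter fun x => 0 < f x).card = Fintype.card α := by
  rw [Fintype.card_subtype, ← card_union_of_disjoint, ← card_univ]
  · congr 1
    ext x
    simp only [mem_union, mem_filter, mem_univ, true_and, iff_true]
    omega
  · rw [disjoint_filter]
    intro x _ hx
    omega

lemma exists_equiv_of_card_filter_lt_eq {α β : Type*} [Fintype α] [Fintype β]
    (hcard : Fintype.card α = Fintype.card β) (f : α → ℕ) (g : β → ℕ)
    (h : ∀ k, (univ.filter fun a => k < f a).card = (univ.filter fun b => k < g b).card) :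
    ∃ e : α ≃ β, ∀ a, g (e a) = f a := by
  have hfib : ∀ c, Fintype.card {a // f a = c} = Fintype.card {b // g b = c} := by
    rintro (_ | c)
    · have h1 := card_fiber_zero_add f
      have h2 := card_fiber_zero_add g
      have := h 0
      omega
    · have h1 := card_fiber_succ_add f c
      have h2 := card_fiber_succ_add g c
      have := h c
      have := h (c + 1)
      omega
  exact ⟨Equiv.ofFiberEquiv fun c => Fintype.equivOfCardEq (hfib c),
    fun a => Equiv.ofFiberEquiv_map _ a⟩

lemma sum_le_sum_of_card_filter_lt_le {α β : Type*} [Fintype α] [Fintype β]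
    (hcard : Fintype.card α = Fintype.card β) (f : α → ℕ) (g : β → ℕ) (M : ℕ)
    (hf : ∀ a, f a ≤ M) (hg : ∀ b, g b ≤ M)
    (h : ∀ k < M, (univ.filter fun b => k < g b).card ≤ (univ.filter fun a => k < f a).card) :
    ∑ b, g b ≤ ∑ a, f a ∧ (∑ a, f a ≤ ∑ b, g b → ∃ e : α ≃ β, ∀ a, g (e a) = f a) := by
  rw [sum_eq_sum_card_filter_lt f M hf, sum_eq_sum_card_filter_lt g M hg]
  have hle : ∀ k ∈ range M, (univ.filter fun b => k < g b).card ≤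
      (univ.filter fun a => k < f a).card := fun k hk => h k (mem_range.1 hk)
  refine ⟨sum_le_sum hle, fun hge => exists_equiv_of_card_filter_lt_eq hcard f g fun k => ?_⟩
  by_cases hk : k < M
  · exact ((sum_eq_sum_iff_of_le hle).1 (le_antisymm (sum_le_sum hle) hge) k
      (mem_range.2 hk)).symm
  · rw [filter_false_of_mem, filter_false_of_mem]
    · simp
    · intro b _
      have := hg b
      omega
    · intro a _
      have := hf a
      omega

end Counting

section Distance

open Finset

lemma le_add_dist_of_adj {G : SimpleGraph V} (hG : G.Connected) (F : V → ℕ)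
    (hF : ∀ x y, G.Adj x y → F y ≤ F x + 1) (x y : V) : F y ≤ F x + G.dist x y := by
  obtain ⟨p, hp⟩ := hG.exists_walk_length_eq_dist x y
  rw [← hp]
  clear hp
  induction p with
  | nil => simp
  | cons h p ih =>
    have := hF _ _ h
    simp only [SimpleGraph.Walk.length_cons]
    omega

lemma dist_map_le {G : SimpleGraph V} {H : SimpleGraph W} (hG : G.Connected) (hH : H.Connected)
    (f : V → W) (hf : ∀ x y, G.Adj x y → f x = f y ∨ H.Adj (f x) (f y)) (x y : V) :
    H.dist (f x) (f y) ≤ G.dist x y := by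
  have := le_add_dist_of_adj hG (fun z => H.dist (f x) (f z)) (fun a b hab => by
    rcases hf a b hab with h | h
    · simp [h]
    · have := hH.dist_triangle (u := f x) (v := f a) (w := f b)
      rw [SimpleGraph.dist_eq_one_iff_adj.2 h] at this
      exact this) x y
  simpa using this

lemma exists_adj_dist_eq {G : SimpleGraph V} (hG : G.Connected) (u x : V) (k : ℕ)
    (h : G.dist u x = k + 1) : ∃ y, G.Adj y x ∧ G.dist u y = k := by
  obtain ⟨p, hp⟩ := hG.exists_walk_length_eq_dist x u
  rw [SimpleGraph.dist_comm, h] at hp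
  cases p with
  | nil => simp at hp
  | cons hadj p =>
    rename_i y
    refine ⟨y, hadj.symm, ?_⟩
    have h1 := SimpleGraph.dist_le p
    have h2 := hG.dist_triangle (u := u) (v := y) (w := x)
    rw [SimpleGraph.dist_eq_one_iff_adj.2 hadj.symm] at h2
    rw [SimpleGraph.dist_comm] at h1
    simp only [SimpleGraph.Walk.length_cons] at hp
    omega

lemma exists_dist_eq_of_le {G : SimpleGraph V} (hG : G.Connected) (u x : V) (k : ℕ)
    (h : k ≤ G.dist u x) : ∃ y, G.dist u y = k := by
  induction h using Nat.decreasingInduction with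
  | self => exact ⟨x, rfl⟩
  | of_succ j _ ih =>
    obtain ⟨y, hy⟩ := ih
    obtain ⟨z, -, hz⟩ := exists_adj_dist_eq hG u y j hy
    exact ⟨z, hz⟩

lemma card_filter_lt_dist_le [Fintype V] {G : SimpleGraph V} (hG : G.Connected) (u : V) (k : ℕ) :
    (univ.filter fun x => k < G.dist u x).card ≤ Fintype.card V - 1 - k := by
  rcases (univ.filter fun x => k < G.dist u x).eq_empty_or_nonempty with h | ⟨x, hx⟩
  · simp [h]
  · have hx : k < G.dist u x := by simpa using hx
    have hsub : range (k + 1) ⊆ (univ.filter fun x => ¬ k < G.dist u x).image (G.dist u) := by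
      intro j hj
      rw [mem_range] at hj
      obtain ⟨y, hy⟩ := exists_dist_eq_of_le hG u x j (by omega)
      exact mem_image.2 ⟨y, by simp; omega, hy⟩
    have h1 := (card_le_card hsub).trans card_image_le
    have h2 := card_filter_add_card_filter_not (s := (univ : Finset V))
      (fun x => k < G.dist u x)
    rw [card_univ] at h2
    rw [card_range] at h1
    omega

lemma dist_add_card_le [Fintype V] {G : SimpleGraph V} (hG : G.Connected) (v : V) (s : Finset V)
    (hs : ∀ x ∈ s, G.Adj v x) (u x : V) : G.dist u x + s.card ≤ Fintype.card V + 1 := by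
  have hv : v ∉ s := fun h => (hs v h).ne rfl
  set l := G.dist u v
  have hsub : range (G.dist u x + 1) ⊆ (insert v s)ᶜ.image (G.dist u) ∪ {l - 1, l, l + 1} := by
    intro j hj
    rw [mem_range] at hj
    obtain ⟨y, hy⟩ := exists_dist_eq_of_le hG u x j (by omega)
    by_cases hys : y ∈ insert v s
    · refine mem_union_right _ ?_
      simp only [mem_insert, mem_singleton]
      rcases mem_insert.1 hys with rfl | hys
      · omega
      · have hadj := SimpleGraph.dist_eq_one_iff_adj.2 (hs y hys)
        have h1 := hG.dist_triangle (u := u) (v := v) (w := y)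
        have h2 := hG.dist_triangle (u := u) (v := y) (w := v)
        rw [SimpleGraph.dist_comm (u := y) (v := v)] at h2
        omega
    · exact mem_union_left _ (mem_image.2 ⟨y, mem_compl.2 hys, hy⟩)
  have h1 := (card_le_card hsub).trans (card_union_le _ _)
  have h2 : ((insert v s)ᶜ.image (G.dist u)).card ≤ _ := card_image_le
  have h3 : ({l - 1, l, l + 1} : Finset ℕ).card ≤ 3 := card_le_three
  have h4 := card_add_card_compl (insert v s)
  rw [card_insert_of_notMem hv] at h4
  rw [card_range] at h1
  omega

lemma connected_induce_ne_of_dist_le {G : SimpleGraph V} (hG : G.Connected) {u v : V}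
    (huv : v ≠ u) (hu : ∀ x, G.dist v x ≤ G.dist v u) :
    (G.induce {x | x ≠ u}).Connected := by
  have key : ∀ k (x : V) (hx : x ≠ u), G.dist v x = k →
      (G.induce {x | x ≠ u}).Reachable ⟨v, huv⟩ ⟨x, hx⟩ := by
    intro k
    induction k with
    | zero =>
      intro x hx h
      obtain rfl := (hG.dist_eq_zero_iff).1 h
      exact SimpleGraph.Reachable.refl _
    | succ k ih =>
      intro x hx h
      obtain ⟨y, hadj, hy⟩ := exists_adj_dist_eq hG v x k h
      have hyu : y ≠ u := by
        rintro rfl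
        have := hu x
        omega
      exact (ih y hyu hy).trans (SimpleGraph.Adj.reachable (by simpa using hadj))
  refine (SimpleGraph.connected_iff_exists_forall_reachable _).2 ⟨⟨v, huv⟩, ?_⟩
  rintro ⟨x, hx⟩
  exact key _ x hx rfl

/-- The sum of the distances over all ordered pairs of vertices. -/
def distSum [Fintype V] (G : SimpleGraph V) : ℕ := ∑ u : V, ∑ v : V, G.dist u v

lemma wienerIndex_eq_distSum [Fintype V] (G : SimpleGraph V) :
    wienerIndex G = (1 / 2) * (distSum G : ℝ) := by
  simp [wienerIndex, distSum]

lemma distSum_le_of_equiv [Fintype V] [Fintype W] {G : SimpleGraph V} {H : SimpleGraph W}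
    (hG : G.Connected) (hH : H.Connected) (e : V ≃ W)
    (he : ∀ x y, G.Adj x y → H.Adj (e x) (e y)) :
    distSum H ≤ distSum G ∧ (distSum H = distSum G → Nonempty (H ≃g G)) := by
  have hsum : distSum H = ∑ x, ∑ y, H.dist (e x) (e y) := by
    unfold distSum
    rw [← Equiv.sum_comp e]
    exact sum_congr rfl fun x _ => (Equiv.sum_comp e _).symm
  have hle : ∀ x y, H.dist (e x) (e y) ≤ G.dist x y :=
    dist_map_le hG hH e fun x y h => Or.inr (he x y h)
  rw [hsum]
  refine ⟨sum_le_sum fun x _ => sum_le_sum fun y _ => hle x y, fun heq => ?_⟩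
  have hxy : ∀ x y, H.dist (e x) (e y) = G.dist x y := fun x y =>
    (sum_eq_sum_iff_of_le fun y _ => hle x y).1
      ((sum_eq_sum_iff_of_le fun x _ => sum_le_sum fun y _ => hle x y).1 heq x (mem_univ x))
      y (mem_univ y)
  refine ⟨(RelIso.symm ⟨e, ?_⟩ : H ≃g G)⟩
  intro x y
  rw [← SimpleGraph.dist_eq_one_iff_adj, ← SimpleGraph.dist_eq_one_iff_adj, hxy]

lemma distSum_le_induce_add [Fintype V] {G : SimpleGraph V} (hG : G.Connected) (u : V)
    (hu : (G.induce {x | x ≠ u}).Connected) :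
    distSum G ≤ distSum (G.induce {x | x ≠ u}) + 2 * ∑ x, G.dist u x := by
  have hsplit : ∀ φ : V → ℕ, ∑ x, φ x = φ u + ∑ x : {x | x ≠ u}, φ x := by
    intro φ
    rw [← Equiv.sum_comp (Equiv.optionSubtypeNe u), Fintype.sum_option]
    rfl
  have hle : ∀ x y : {x | x ≠ u}, G.dist x y ≤ (G.induce {x | x ≠ u}).dist x y :=
    dist_map_le hu hG (fun x : {x | x ≠ u} => (x : V)) fun x y h => Or.inr h
  have h1 : ∑ x : {x | x ≠ u}, ∑ y, G.dist x y =
      ∑ x : {x | x ≠ u}, G.dist u x + ∑ x : {x | x ≠ u}, ∑ y : {x | x ≠ u}, G.dist x y := by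
    rw [← sum_add_distrib]
    refine sum_congr rfl fun x _ => ?_
    rw [hsplit, SimpleGraph.dist_comm]
  have h2 : ∑ x : {x | x ≠ u}, ∑ y : {x | x ≠ u}, G.dist x y ≤
      distSum (G.induce {x | x ≠ u}) := sum_le_sum fun x _ => sum_le_sum fun y _ => hle x y
  have h3 := hsplit (G.dist u)
  have h4 : distSum G = _ := hsplit fun x => ∑ y, G.dist x y
  rw [SimpleGraph.dist_self] at h3
  omega

end Distance

section Extremal

open Finset

lemma TnD_adj {n Δ : ℕ} {i j : Fin n} : (TnD n Δ).Adj i j ↔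
    (i.val + 1 = j.val ∧ j.val ≤ n - Δ) ∨ (i.val = n - Δ ∧ n - Δ < j.val) ∨
    (j.val + 1 = i.val ∧ i.val ≤ n - Δ) ∨ (j.val = n - Δ ∧ n - Δ < i.val) := by
  rw [TnD, SimpleGraph.fromRel_adj, ne_eq, Fin.ext_iff]
  omega

lemma TnD_connected {n Δ : ℕ} (hΔ : 1 ≤ Δ) (hn : Δ < n) : (TnD n Δ).Connected := by
  have key : ∀ k (hk : k < n), (TnD n Δ).Reachable ⟨0, by omega⟩ ⟨k, hk⟩ := by
    intro k
    induction k using Nat.strong_induction_on with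
    | _ k ih =>
      intro hk
      rcases Nat.eq_zero_or_pos k with rfl | hpos
      · exact SimpleGraph.Reachable.refl _
      by_cases h : k ≤ n - Δ
      · refine (ih (k - 1) (by omega) (by omega)).trans (SimpleGraph.Adj.reachable ?_)
        rw [TnD_adj]
        dsimp only
        omega
      · refine (ih (n - Δ) (by omega) (by omega)).trans (SimpleGraph.Adj.reachable ?_)
        rw [TnD_adj]
        dsimp only
        omega
  exact (SimpleGraph.connected_iff_exists_forall_reachable _).2
    ⟨⟨0, by omega⟩, fun i => key i.val i.isLt⟩

lemma min_le_dist_TnD {n Δ : ℕ} (hΔ : 1 ≤ Δ) (hn : Δ ≤ n) (i : Fin (n + 1)) :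
    min i.val (n + 1 - Δ + 1) ≤ (TnD (n + 1) Δ).dist 0 i := by
  have := le_add_dist_of_adj (TnD_connected hΔ (Nat.lt_succ_of_le hn))
    (fun j : Fin (n + 1) => min j.val (n + 1 - Δ + 1)) (fun x y h => by
      rw [TnD_adj] at h
      omega) 0 i
  simpa using this

lemma distSum_TnD_add_le {n Δ : ℕ} (hΔ : 1 ≤ Δ) (hn : Δ < n) :
    distSum (TnD n Δ) + 2 * ∑ i : Fin (n + 1), min i.val (n + 1 - Δ + 1) ≤
      distSum (TnD (n + 1) Δ) := by
  set T := TnD (n + 1) Δ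
  have hshift : ∀ i j : Fin n, (TnD n Δ).dist i j ≤ T.dist i.succ j.succ := by
    intro i j
    have := dist_map_le (TnD_connected hΔ (hn.trans (Nat.lt_succ_self n))) (TnD_connected hΔ hn)
      (fun x : Fin (n + 1) => (⟨x.val - 1, by omega⟩ : Fin n)) (fun x y h => by
        rw [TnD_adj] at h
        rw [TnD_adj, Fin.ext_iff]
        dsimp only
        omega) i.succ j.succ
    simpa using this
  have h1 : ∑ i : Fin (n + 1), min i.val (n + 1 - Δ + 1) ≤ ∑ i, T.dist 0 i :=
    sum_le_sum fun i _ => min_le_dist_TnD hΔ hn.le i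
  have h2 : distSum (TnD n Δ) ≤ ∑ i : Fin n, ∑ j : Fin n, T.dist i.succ j.succ :=
    sum_le_sum fun i _ => sum_le_sum fun j _ => hshift i j
  have h3 : ∑ i, T.dist 0 i = T.dist 0 0 + ∑ i : Fin n, T.dist 0 i.succ := Fin.sum_univ_succ _
  have h4 : distSum T = ∑ i, T.dist 0 i + ∑ i : Fin n, ∑ j, T.dist i.succ j :=
    Fin.sum_univ_succ _
  have h5 : ∑ i : Fin n, ∑ j, T.dist i.succ j =
      ∑ i : Fin n, T.dist 0 i.succ + ∑ i : Fin n, ∑ j : Fin n, T.dist i.succ j.succ := by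
    rw [← sum_add_distrib]
    refine sum_congr rfl fun i _ => ?_
    rw [Fin.sum_univ_succ, SimpleGraph.dist_comm]
  rw [SimpleGraph.dist_self] at h3
  omega

lemma card_filter_lt_min {n M k : ℕ} (hk : k < M) :
    (univ.filter fun i : Fin n => k < min i.val M).card = n - 1 - k := by
  have h : (univ.filter fun i : Fin n => k < min i.val M) =
      univ.filter fun i : Fin n => ¬ i.val < k + 1 := by
    refine filter_congr fun i _ => ?_
    omega
  have h1 := card_filter_add_card_filter_not (s := (univ : Finset (Fin n)))
    (fun i => i.val < k + 1)
  rw [Fin.card_filter_val_lt, card_univ, Fintype.card_fin] at h1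
  rw [h]
  omega

lemma sum_dist_le [Fintype V] {G : SimpleGraph V} {n Δ : ℕ} (hcard : Fintype.card V = n)
    (hG : G.Connected) (v : V) (s : Finset V) (hs : ∀ x ∈ s, G.Adj v x) (hsΔ : s.card = Δ)
    (hn : Δ ≤ n) (u : V) :
    ∑ x, G.dist u x ≤ ∑ i : Fin n, min i.val (n - Δ + 1) ∧
      (∑ i : Fin n, min i.val (n - Δ + 1) ≤ ∑ x, G.dist u x →
        ∃ e : Fin n ≃ V, ∀ i, G.dist u (e i) = min i.val (n - Δ + 1)) := by
  refine sum_le_sum_of_card_filter_lt_le (by simp [hcard]) _ _ (n - Δ + 1)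
    (fun i => min_le_right _ _) (fun x => ?_) fun k hk => ?_
  · have := dist_add_card_le hG v s hs u x
    omega
  · rw [card_filter_lt_min hk, ← hcard]
    exact card_filter_lt_dist_le hG u k

lemma adj_of_dist_eq_min {G : SimpleGraph V} {n Δ : ℕ} (hG : G.Connected) (u : V)
    (e : Fin n ≃ V) (he : ∀ i, G.dist u (e i) = min i.val (n - Δ + 1)) (i j : Fin n)
    (hij : (TnD n Δ).Adj i j) : G.Adj (e i) (e j) := by
  have key : ∀ i j : Fin n, i.val ≤ n - Δ → G.dist u (e j) = i.val + 1 →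
      G.Adj (e i) (e j) := by
    intro i j hi hj
    obtain ⟨y, hadj, hy⟩ := exists_adj_dist_eq hG u (e j) i.val hj
    obtain ⟨k, rfl⟩ := e.surjective y
    rw [he] at hy
    have : k = i := Fin.ext (by omega)
    exact this ▸ hadj
  rw [TnD_adj] at hij
  have hi := he i
  have hj := he j
  by_cases h : i.val < j.val
  · exact key i j (by omega) (by omega)
  · exact (key j i (by omega) (by omega)).symm

lemma distSum_le_TnD {Δ : ℕ} (hΔ : 2 ≤ Δ) {n : ℕ} (hn : Δ + 1 ≤ n) :
    ∀ {V : Type*} [Fintype V] (G : SimpleGraph V), Fintype.card V = n → G.Connected →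
      ∀ (v : V) (s : Finset V), (∀ x ∈ s, G.Adj v x) → s.card = Δ →
      distSum G ≤ distSum (TnD n Δ) ∧
        (distSum G = distSum (TnD n Δ) → Nonempty (G ≃g TnD n Δ)) := by
  induction n, hn using Nat.le_induction with
  | base =>
    intro V _ G hcard hG v s hs hsΔ
    have hv : v ∉ s := fun h => (hs v h).ne rfl
    have huniv : insert v s = univ := by
      rw [← card_eq_iff_eq_univ, card_insert_of_notMem hv, hsΔ, hcard]
    have hadj : ∀ x, x ≠ v → G.Adj v x := fun x hx =>
      hs x ((mem_insert.1 (huniv ▸ mem_univ x)).resolve_left hx)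
    let e₀ : Fin (Δ + 1) ≃ V := Fintype.equivOfCardEq (by simp [hcard])
    let c : Fin (Δ + 1) := ⟨1, by omega⟩
    let e : Fin (Δ + 1) ≃ V := e₀.trans (Equiv.swap (e₀ c) v)
    have hec : e c = v := by simp [e]
    refine distSum_le_of_equiv (TnD_connected (by omega) (by omega)) hG e fun i j hij => ?_
    have hne : i ≠ j := hij.ne
    rw [TnD_adj] at hij
    have : i = c ∨ j = c := by
      simp only [Fin.ext_iff, c]
      omega
    rcases this with rfl | rfl
    · rw [hec]
      exact hadj _ fun h => hne (e.injective (hec.trans h.symm))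
    · rw [hec]
      exact (hadj _ fun h => hne (e.injective (h.trans hec.symm))).symm
  | succ n hn ih =>
    intro V _ G hcard hG v s hs hsΔ
    have hv : v ∉ s := fun h => (hs v h).ne rfl
    have hnonempty : (insert v s)ᶜ.Nonempty := by
      rw [← card_pos]
      have := card_add_card_compl (insert v s)
      rw [card_insert_of_notMem hv] at this
      omega
    obtain ⟨u, hu, hmax⟩ := exists_max_image _ (G.dist v) hnonempty
    simp only [mem_compl, mem_insert, not_or] at hu hmax
    have hfar : ∀ x, G.dist v x ≤ G.dist v u := by
      intro x
      have hpos := hG.pos_dist_of_ne (Ne.symm hu.1)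
      by_cases hxv : x = v
      · simp [hxv]
      by_cases hxs : x ∈ s
      · rw [SimpleGraph.dist_eq_one_iff_adj.2 (hs x hxs)]
        exact hpos
      · exact hmax x ⟨hxv, hxs⟩
    have hconn := connected_induce_ne_of_dist_le hG (Ne.symm hu.1) hfar
    have hcard' : Fintype.card {x | x ≠ u} = n := by
      have := Set.card_ne_eq u
      omega
    have hind := (ih (G.induce {x | x ≠ u}) hcard' hconn ⟨v, Ne.symm hu.1⟩
      (s.subtype (· ∈ {x | x ≠ u})) (fun x hx => hs x (mem_subtype.1 hx)) (by
        rw [card_subtype, filter_true_of_mem, hsΔ]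
        rintro x hx rfl
        exact hu.2 hx)).1
    have hdel := distSum_le_induce_add hG u hconn
    have hT := distSum_TnD_add_le (Δ := Δ) (n := n) (by omega) (by omega)
    obtain ⟨htr, htr_eq⟩ := sum_dist_le hcard hG v s hs hsΔ (by omega) u
    refine ⟨by omega, fun heq => ?_⟩
    obtain ⟨e, he⟩ := htr_eq (by omega)
    exact (distSum_le_of_equiv (TnD_connected (by omega) (by omega)) hG e
      (adj_of_dist_eq_min hG u e he)).2 heq

end Extremal

/-- Among connected graphs on `n` vertices with maximum degree `Δ ≥ 2`, the Wiener index
is maximized exactly by `T_{n,Δ}`. -/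
theorem statement6 [Fintype V] (G : SimpleGraph V) (n Δ : ℕ)
    (hcard : Fintype.card V = n) (hconn : G.Connected)
    (hmax : HasMaxDegree G Δ) (hΔ : 2 ≤ Δ) :
    wienerIndex G ≤ wienerIndex (TnD n Δ)
    ∧ (wienerIndex G = wienerIndex (TnD n Δ) ↔ Nonempty (G ≃g TnD n Δ)) := by
  obtain ⟨v, hv⟩ := hmax.2
  have hdeg : (Finset.univ.filter fun x => G.Adj v x).card = Δ := by
    rw [← hv, degree', Nat.card_eq_fintype_card, ← Fintype.card_subtype]
    rfl
  have hlt : (Finset.univ.filter fun x => G.Adj v x).card < Fintype.card V := by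
    rw [← Finset.card_univ]
    exact Finset.card_lt_card (Finset.filter_ssubset.2 ⟨v, Finset.mem_univ v, G.irrefl⟩)
  obtain ⟨hle, heq⟩ := distSum_le_TnD hΔ (n := n) (by omega) G hcard hconn v _
    (fun x hx => (Finset.mem_filter.1 hx).2) hdeg
  have hT := TnD_connected (n := n) (Δ := Δ) (by omega) (by omega)
  rw [wienerIndex_eq_distSum, wienerIndex_eq_distSum]
  refine ⟨?_, fun h => heq ?_, ?_⟩
  · gcongr
  · have : (distSum G : ℝ) = distSum (TnD n Δ) := by linarith
    exact_mod_cast this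
  · rintro ⟨φ⟩
    rw [le_antisymm hle (distSum_le_of_equiv hconn hT φ.toEquiv
      fun x y h => φ.map_rel_iff.2 h).1]

end KfPaper
end
end

section
/- For n ≥ Δ ≥ 2, the Wiener index of T_{n,Δ} satisfies W(T_{n,Δ}) = C(n−Δ+2, 3) + (Δ−1)(n−Δ+1)(n−Δ+2)/2 + (Δ−1)(Δ−2), where C(m,3) denotes the binomial coefficient m choose 3. -/
open scoped Classical

noncomputable section

namespace KfPaper

variable {V : Type*} {W : Type*}

/-- A function that vanishes only at `u`, grows by at most one along edges, and drops by one along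
some edge at every other vertex is the distance from `u`. -/
theorem dist_eq_of_forall_adj (G : SimpleGraph V) (u : V) (D : V → ℕ) (h0 : D u = 0)
    (hstep : ∀ v w, G.Adj v w → D w ≤ D v + 1)
    (hpred : ∀ v, v ≠ u → ∃ w, G.Adj w v ∧ D v = D w + 1) (v : V) :
    G.dist u v = D v := by
  have hwalk : ∀ k v, D v = k → ∃ p : G.Walk u v, p.length = k := by
    intro k
    induction k with
    | zero =>
      intro v hv
      by_cases h : v = u
      · subst h
        exact ⟨.nil, rfl⟩
      · obtain ⟨w, -, hw⟩ := hpred v h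
        omega
    | succ k ih =>
      intro v hv
      have h : v ≠ u := by
        rintro rfl
        omega
      obtain ⟨w, hadj, hw⟩ := hpred v h
      obtain ⟨p, hp⟩ := ih w (by omega)
      exact ⟨p.concat hadj, by rw [SimpleGraph.Walk.length_concat, hp]⟩
  have hle : ∀ {a b : V} (p : G.Walk a b), D b ≤ D a + p.length := by
    intro a b p
    induction p with
    | nil => simp
    | cons h p ih =>
      have := hstep _ _ h
      rw [SimpleGraph.Walk.length_cons]
      omega
  obtain ⟨p, hp⟩ := hwalk (D v) v rfl
  apply le_antisymm
  · exact hp ▸ SimpleGraph.dist_le p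
  · obtain ⟨q, hq⟩ := p.reachable.exists_walk_length_eq_dist
    have := hle q
    omega

/-- The distance in `TnD n Δ` between vertices `i` and `j`, where `m = n - Δ`. -/
def broomDist (m i j : ℕ) : ℕ :=
  if i = j then 0
  else if m < i ∧ m < j then 2
  else (min i (m + 1) - min j (m + 1)) + (min j (m + 1) - min i (m + 1))

theorem broomDist_self (m i : ℕ) : broomDist m i i = 0 := by
  simp [broomDist]

theorem broomDist_comm (m i j : ℕ) : broomDist m i j = broomDist m j i := by
  unfold broomDist
  split_ifs <;> omega

theorem adj_TnD {n Δ : ℕ} {i j : Fin n} :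
    (TnD n Δ).Adj i j ↔
      ((i.val + 1 = j.val ∧ j.val ≤ n - Δ) ∨ (i.val = n - Δ ∧ n - Δ < j.val)) ∨
      ((j.val + 1 = i.val ∧ i.val ≤ n - Δ) ∨ (j.val = n - Δ ∧ n - Δ < i.val)) := by
  rw [TnD, SimpleGraph.fromRel_adj, and_iff_right_iff_imp]
  rintro h rfl
  omega

theorem dist_TnD {n Δ : ℕ} (hΔ : 1 ≤ Δ) (i j : Fin n) :
    (TnD n Δ).dist i j = broomDist (n - Δ) i j := by
  refine dist_eq_of_forall_adj _ i (fun j => broomDist (n - Δ) i j) (broomDist_self _ _) ?_ ?_ j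
  · intro v w h
    rw [adj_TnD] at h
    simp only [broomDist]
    split_ifs <;> omega
  · intro v hv
    have hv' : v.val ≠ i.val := fun h => hv (Fin.ext h)
    have hvn := v.isLt
    have hin := i.isLt
    obtain ⟨w, hwn, hw⟩ : ∃ w < n, w =
        if n - Δ < v.val then n - Δ
        else if i.val < v.val then v.val - 1
        else if v.val = n - Δ then i.val else v.val + 1 := by
      refine ⟨_, ?_, rfl⟩
      split_ifs <;> omega
    refine ⟨⟨w, hwn⟩, ?_, ?_⟩
    · rw [adj_TnD]
      simp only
      split_ifs at hw <;> omega
    · simp only [broomDist]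
      split_ifs at hw <;> split_ifs <;> omega

/-- A symmetric double sum vanishing on the diagonal is twice the sum below the diagonal. -/
theorem sum_range_sum_range_eq_two_mul {f : ℕ → ℕ → ℝ} (hself : ∀ i, f i i = 0)
    (hcomm : ∀ i j, f i j = f j i) (n : ℕ) :
    ∑ i ∈ Finset.range n, ∑ j ∈ Finset.range n, f i j =
      2 * ∑ i ∈ Finset.range n, ∑ j ∈ Finset.range i, f i j := by
  induction n with
  | zero => simp
  | succ n ih =>
    simp only [Finset.sum_range_succ, Finset.sum_add_distrib, ih, hself, hcomm _ n]
    ring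

theorem sum_range_sub_cast (n : ℕ) :
    ∑ j ∈ Finset.range n, ((n : ℝ) - j) = n * (n + 1) / 2 := by
  have h : ∀ k : ℕ, ∑ j ∈ Finset.range k, ((n : ℝ) - j) = k * n - k * (k - 1) / 2 := by
    intro k
    induction k with
    | zero => simp
    | succ k ih =>
      rw [Finset.sum_range_succ, ih]
      push_cast
      ring
  rw [h]
  ring

theorem sum_broomDist_path {m i : ℕ} (hi : i ≤ m + 1) :
    ∑ j ∈ Finset.range i, (broomDist m i j : ℝ) = i * (i + 1) / 2 := by
  rw [← sum_range_sub_cast]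
  refine Finset.sum_congr rfl fun j hj => ?_
  rw [Finset.mem_range] at hj
  rw [← Nat.cast_sub hj.le]
  congr 1
  unfold broomDist
  split_ifs <;> omega

theorem sum_broomDist_leaf (m t : ℕ) :
    ∑ j ∈ Finset.range (m + 1 + t), (broomDist m (m + 1 + t) j : ℝ) =
      (m + 1) * (m + 2) / 2 + 2 * t := by
  rw [Finset.sum_range_add]
  congr 1
  · have h := sum_broomDist_path (le_refl (m + 1))
    push_cast at h
    rw [show (m : ℝ) + 2 = m + 1 + 1 by ring, ← h]
    refine Finset.sum_congr rfl fun j hj => ?_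
    rw [Finset.mem_range] at hj
    congr 1
    unfold broomDist
    split_ifs <;> omega
  · have h : ∀ j ∈ Finset.range t, (broomDist m (m + 1 + t) (m + 1 + j) : ℝ) = 2 := by
      intro j hj
      rw [Finset.mem_range] at hj
      have : broomDist m (m + 1 + t) (m + 1 + j) = 2 := by
        unfold broomDist
        split_ifs <;> omega
      exact_mod_cast this
    rw [Finset.sum_congr rfl h]
    simp [mul_comm]

theorem sum_sum_broomDist_path (m k : ℕ) (hk : k ≤ m + 1) :
    ∑ i ∈ Finset.range k, ∑ j ∈ Finset.range i, (broomDist m i j : ℝ) =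
      ((k + 1).choose 3 : ℝ) := by
  induction k with
  | zero => simp [Nat.choose]
  | succ k ih =>
    rw [Finset.sum_range_succ, ih (by omega), sum_broomDist_path (by omega),
      Nat.choose_succ_succ' (k + 1) 2, Nat.cast_add, Nat.cast_choose_two]
    push_cast
    ring

theorem sum_sum_broomDist (m k : ℕ) :
    ∑ i ∈ Finset.range (m + 1 + k), ∑ j ∈ Finset.range i, (broomDist m i j : ℝ) =
      ((m + 2).choose 3 : ℝ) + k * (m + 1) * (m + 2) / 2 + k * (k - 1) := by
  induction k with
  | zero => simpa using sum_sum_broomDist_path m (m + 1) le_rfl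
  | succ k ih =>
    rw [← add_assoc, Finset.sum_range_succ, ih, sum_broomDist_leaf]
    push_cast
    ring

/-- The Wiener index of `T_{n,Δ}`:
`W(T_{n,Δ}) = C(n−Δ+2, 3) + (Δ−1)(n−Δ+1)(n−Δ+2)/2 + (Δ−1)(Δ−2)`. -/
theorem statement14 (n Δ : ℕ) (hΔ : 2 ≤ Δ) (hn : Δ ≤ n) :
    wienerIndex (TnD n Δ)
      = (Nat.choose (n - Δ + 2) 3 : ℝ)
        + ((Δ : ℝ) - 1) * ((n : ℝ) - (Δ : ℝ) + 1) * ((n : ℝ) - (Δ : ℝ) + 2) / 2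
        + ((Δ : ℝ) - 1) * ((Δ : ℝ) - 2) := by
  obtain ⟨k, rfl⟩ : ∃ k, Δ = k + 1 := ⟨Δ - 1, by omega⟩
  obtain ⟨m, rfl⟩ : ∃ m, n = m + 1 + k := ⟨n - (k + 1), by omega⟩
  have hm : m + 1 + k - (k + 1) = m := by omega
  simp only [wienerIndex, dist_TnD (show 1 ≤ k + 1 by omega), hm]
  have hsum := sum_range_sum_range_eq_two_mul (f := fun i j => (broomDist m i j : ℝ))
    (fun i => by simp [broomDist_self]) (fun i j => by rw [broomDist_comm]) (m + 1 + k)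
  simp only [Finset.sum_range (n := m + 1 + k)] at hsum
  rw [hsum, ← Finset.sum_range (fun i => ∑ j ∈ Finset.range i, (broomDist m i j : ℝ)),
    sum_sum_broomDist]
  push_cast
  ring

end KfPaper
end
end
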